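/- arXiv:2502.17591 — 2 statements merged into one kernel-verified Lean document; each statement's English description precedes it below -/
import Mathlib

section
/- Let V be a nonempty finite type and n : ℕ. Let p and q be pmfs on Fin n → V with q x > 0 for all x, and let L denote the prefix cross-entropy. Then L is non-decreasing on {0, 1, …, n}: for every k < n, L k ≤ L (k+1). -/
open Finset
open scoped Classical

/-- The `k`-th marginal of `r : (Fin n → V) → ℝ`: the sum of `r` over all sequences
`x : Fin n → V` whose length-`k` prefix is `z` (for `k ≤ n`, the condition
`∀ i : Fin k, ∀ hi : (i : ℕ) < n, x ⟨i, hi⟩ = z i` says exactly that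
`x (Fin.castLE h i) = z i` for all `i : Fin k`). -/
noncomputable def marginal {V : Type*} [Fintype V] {n : ℕ} (r : (Fin n → V) → ℝ)
    (k : ℕ) (z : Fin k → V) : ℝ :=
  ∑ x : Fin n → V, if (∀ i : Fin k, ∀ hi : (i : ℕ) < n, x ⟨(i : ℕ), hi⟩ = z i) then r x else 0

/-- The prefix cross-entropy `L k` of `p` against `q` over prefixes of length `k`. -/
noncomputable def prefixCE {V : Type*} [Fintype V] {n : ℕ}
    (p q : (Fin n → V) → ℝ) (k : ℕ) : ℝ :=
  -∑ z : Fin k → V, marginal p k z * Real.log (marginal q k z)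

/-- Summing a function of the prefix against the marginal is summing it against `r`. -/
theorem sum_marginal_mul {V : Type*} [Fintype V] {n k : ℕ} (h : k ≤ n)
    (r : (Fin n → V) → ℝ) (f : (Fin k → V) → ℝ) :
    ∑ z, marginal r k z * f z = ∑ x, r x * f (fun i => x (Fin.castLE h i)) := by
  simp only [marginal, Finset.sum_mul]
  rw [Finset.sum_comm]
  refine Finset.sum_congr rfl fun x _ => ?_
  rw [Finset.sum_eq_single (fun i => x (Fin.castLE h i))]
  · exact congrArg (· * _) (if_pos fun _ _ => rfl)
  · intro z _ hz
    rw [if_neg fun hx => hz (funext fun i => (hx i (i.2.trans_le h)).symm), zero_mul]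
  · simp

theorem le_marginal_prefix {V : Type*} [Fintype V] {n k : ℕ} (h : k ≤ n)
    {r : (Fin n → V) → ℝ} (hr : ∀ x, 0 ≤ r x) (x : Fin n → V) :
    r x ≤ marginal r k (fun i => x (Fin.castLE h i)) := by
  refine le_trans (le_of_eq ?_) (Finset.single_le_sum (fun y _ => ?_) (Finset.mem_univ x))
  · exact (if_pos fun _ _ => rfl).symm
  · split_ifs
    exacts [hr y, le_rfl]

theorem marginal_prefix_antitone {V : Type*} [Fintype V] {n k m : ℕ} (hkm : k ≤ m) (hm : m ≤ n)
    {r : (Fin n → V) → ℝ} (hr : ∀ x, 0 ≤ r x) (x : Fin n → V) :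
    marginal r m (fun i => x (Fin.castLE hm i)) ≤
      marginal r k (fun i => x (Fin.castLE (hkm.trans hm) i)) := by
  refine Finset.sum_le_sum fun y _ => ?_
  split_ifs with h₁ h₂
  · exact le_rfl
  · exact absurd (fun i hi => h₁ (Fin.castLE hkm i) hi) h₂
  · exact hr y
  · exact le_rfl

/-- The prefix cross-entropy is non-decreasing in the prefix length. -/
theorem prefixCE_monotone {V : Type*} [Fintype V] [Nonempty V] {n : ℕ}
    (p q : (Fin n → V) → ℝ)
    (hp0 : ∀ x, 0 ≤ p x) (hp1 : ∑ x, p x = 1)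
    (hq0 : ∀ x, 0 < q x) (hq1 : ∑ x, q x = 1)
    {k : ℕ} (hk : k < n) :
    prefixCE p q k ≤ prefixCE p q (k + 1) := by
  unfold prefixCE
  rw [sum_marginal_mul hk.le, sum_marginal_mul (Nat.succ_le_of_lt hk), neg_le_neg_iff]
  have hq : ∀ x, 0 ≤ q x := fun x => (hq0 x).le
  refine Finset.sum_le_sum fun x _ => mul_le_mul_of_nonneg_left ?_ (hp0 x)
  exact Real.log_le_log ((hq0 x).trans_le (le_marginal_prefix _ hq x))
    (marginal_prefix_antitone k.le_succ hk hq x)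
end

section
/- Let V be a nonempty finite type and n : ℕ. Let p and q be pmfs on Fin n → V with q x > 0 for all x, and let L denote the prefix cross-entropy. Then for every k < n, the increment of L equals the p-expected conditional cross-entropy of the next-token conditional distributions: L (k+1) - L k = ∑ over z : Fin k → V with p_k z > 0, p_k z * ( -∑ v : V, (p_{k+1} (Fin.snoc z v) / p_k z) * Real.log (q_{k+1} (Fin.snoc z v) / q_k z) ). -/
open Finset
open scoped Classical

theorem marginal_nonneg {V : Type*} [Fintype V] {n : ℕ} {r : (Fin n → V) → ℝ}
    (hr : ∀ x, 0 ≤ r x) (k : ℕ) (z : Fin k → V) : 0 ≤ marginal r k z :=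
  Finset.sum_nonneg fun x _ => by split_ifs <;> simp [hr]

theorem marginal_pos {V : Type*} [Fintype V] [Nonempty V] {n : ℕ} {r : (Fin n → V) → ℝ}
    (hr : ∀ x, 0 < r x) (k : ℕ) (z : Fin k → V) : 0 < marginal r k z := by
  refine Finset.sum_pos' (fun x _ => ?_)
    ⟨fun j => if h : (j : ℕ) < k then z ⟨j, h⟩ else Classical.arbitrary V, Finset.mem_univ _, ?_⟩
  · split_ifs
    exacts [(hr x).le, le_rfl]
  · rw [if_pos fun i _ => by simp]
    exact hr _

/-- Summing the `(k + 1)`-th marginal over the last token gives the `k`-th marginal. -/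
theorem sum_marginal_snoc {V : Type*} [Fintype V] {n : ℕ} (r : (Fin n → V) → ℝ)
    {k : ℕ} (hk : k < n) (z : Fin k → V) :
    ∑ v : V, marginal r (k + 1) (Fin.snoc z v) = marginal r k z := by
  unfold marginal
  rw [Finset.sum_comm]
  refine Finset.sum_congr rfl fun x _ => ?_
  simp [Fin.forall_fin_succ', hk, ite_and]

theorem sum_fin_succ_eq_sum_snoc {V M : Type*} [Fintype V] [AddCommMonoid M] {k : ℕ}
    (f : (Fin (k + 1) → V) → M) :
    ∑ y, f y = ∑ z : Fin k → V, ∑ v : V, f (Fin.snoc z v) := by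
  rw [← (Fin.snocEquiv fun _ => V).sum_comp, Fintype.sum_prod_type_right]
  rfl

/-- The chain rule for a single prefix, with weights `a v` summing to `A`. -/
theorem mul_neg_sum_div_mul_log_div {V : Type*} [Fintype V] {a b : V → ℝ} {A B : ℝ}
    (ha : ∑ v, a v = A) (hA : A ≠ 0) (hb : ∀ v, b v ≠ 0) (hB : B ≠ 0) :
    A * (-∑ v, a v / A * Real.log (b v / B)) =
      A * Real.log B - ∑ v, a v * Real.log (b v) := by
  rw [mul_neg, Finset.mul_sum, ← ha, Finset.sum_mul, ← Finset.sum_sub_distrib,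
    ← Finset.sum_neg_distrib, ha]
  refine Finset.sum_congr rfl fun v _ => ?_
  rw [Real.log_div (hb v) hB]
  field_simp
  ring

/-- The increment of the prefix cross-entropy is the `p`-expected conditional
cross-entropy of the next-token conditional distributions. -/
theorem prefixCE_succ_sub_eq_expected_conditional {V : Type*} [Fintype V] [Nonempty V]
    {n : ℕ} (p q : (Fin n → V) → ℝ)
    (hp0 : ∀ x, 0 ≤ p x) (hp1 : ∑ x, p x = 1)
    (hq0 : ∀ x, 0 < q x) (hq1 : ∑ x, q x = 1)
    {k : ℕ} (hk : k < n) :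
    prefixCE p q (k + 1) - prefixCE p q k =
      ∑ z ∈ Finset.univ.filter (fun z : Fin k → V => 0 < marginal p k z),
        marginal p k z *
          (-∑ v : V, (marginal p (k + 1) (Fin.snoc z v) / marginal p k z) *
            Real.log (marginal q (k + 1) (Fin.snoc z v) / marginal q k z)) := by
  rw [prefixCE, prefixCE, sum_fin_succ_eq_sum_snoc, neg_sub_neg, ← Finset.sum_sub_distrib,
    Finset.sum_filter]
  refine Finset.sum_congr rfl fun z _ => ?_
  have hsum := sum_marginal_snoc p hk z
  split_ifs with h
  · exact (mul_neg_sum_div_mul_log_div hsum h.ne' (fun v => (marginal_pos hq0 _ _).ne')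
      (marginal_pos hq0 _ _).ne').symm
  · have hz : marginal p k z = 0 := le_antisymm (not_lt.mp h) (marginal_nonneg hp0 k z)
    rw [hz, Finset.sum_eq_zero_iff_of_nonneg fun v _ => marginal_nonneg hp0 _ _] at hsum
    rw [hz, Finset.sum_eq_zero fun v hv => by rw [hsum v hv, zero_mul]]
    simp
end
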